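/- arXiv:1304.3216 — 2 statements merged into one kernel-verified Lean document; each statement's English description precedes it below -/
import Mathlib

section
/- Let u(x) = ũ(|x|) be a radial C² function on the geodesic ball B vanishing on ∂B, solving −Δ_{B^N}u − λu = u^p, and define v(x) = (x₁/|x|)(1 − |x|²) ũ'(|x|). Then v satisfies the linearized equation −Δ_{B^N}v − λv = p u^{p−1} v in B \ {0}. -/
open scoped RealInnerProductSpace

/-- Euclidean Laplacian of a real-valued function. -/
noncomputable def eucLap {N : ℕ} (f : EuclideanSpace ℝ (Fin N) → ℝ)
    (x : EuclideanSpace ℝ (Fin N)) : ℝ :=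
  ∑ i : Fin N, fderiv ℝ (fun y => fderiv ℝ f y (EuclideanSpace.single i (1 : ℝ)))
    x (EuclideanSpace.single i (1 : ℝ))

/-- Hyperbolic Laplacian on the Poincaré disc:
`Δ_{B^N} = ((1−|x|²)/2)²Δ + (N−2)((1−|x|²)/2)⟨x,∇⟩`. -/
noncomputable def hypLap (N : ℕ) (f : EuclideanSpace ℝ (Fin N) → ℝ)
    (x : EuclideanSpace ℝ (Fin N)) : ℝ :=
  ((1 - ‖x‖ ^ 2) / 2) ^ 2 * eucLap f x +
    ((N : ℝ) - 2) * ((1 - ‖x‖ ^ 2) / 2) * fderiv ℝ f x x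

open Filter Topology

theorem hypLap_congr {N : ℕ} {f g : EuclideanSpace ℝ (Fin N) → ℝ}
    {x : EuclideanSpace ℝ (Fin N)} (h : f =ᶠ[𝓝 x] g) : hypLap N f x = hypLap N g x := by
  have h' : fderiv ℝ f =ᶠ[𝓝 x] fderiv ℝ g := h.fderiv
  have h2 : eucLap f x = eucLap g x := by
    refine Finset.sum_congr rfl fun i _ => ?_
    rw [Filter.EventuallyEq.fderiv_eq (h'.mono fun y hy => by rw [hy])]
  rw [hypLap, hypLap, h2, h.fderiv_eq]

theorem hasFDerivAt_comp_norm {E : Type*} [NormedAddCommGroup E] [InnerProductSpace ℝ E]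
    {φ : ℝ → ℝ} {d : ℝ} {x : E} (hx : x ≠ 0) (h : HasDerivAt φ d ‖x‖) :
    HasFDerivAt (fun y => φ ‖y‖) ((d / ‖x‖) • innerSL ℝ x) x := by
  have hn : ‖x‖ ≠ 0 := norm_ne_zero_iff.2 hx
  have h1 : HasFDerivAt (fun y : E => √(‖y‖ ^ 2)) ((1 / (2 * √(‖x‖ ^ 2))) • (2 • innerSL ℝ x)) x :=
    (hasStrictFDerivAt_norm_sq x).hasFDerivAt.sqrt (by positivity)
  simp only [Real.sqrt_sq (norm_nonneg _)] at h1
  refine (h.comp_hasFDerivAt x h1).congr_fderiv ?_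
  ext v
  simp
  field_simp

theorem hasFDerivAt_coord_mul_comp_norm {N : ℕ} (k : Fin N) {φ : ℝ → ℝ} {d : ℝ}
    {x : EuclideanSpace ℝ (Fin N)} (hx : x ≠ 0) (h : HasDerivAt φ d ‖x‖) :
    HasFDerivAt (fun y : EuclideanSpace ℝ (Fin N) => y k * φ ‖y‖)
      (x k • ((d / ‖x‖) • innerSL ℝ x) +
        φ ‖x‖ • (EuclideanSpace.proj k : EuclideanSpace ℝ (Fin N) →L[ℝ] ℝ)) x :=
  (EuclideanSpace.proj (𝕜 := ℝ) k).hasFDerivAt.mul (hasFDerivAt_comp_norm hx h)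

theorem hypLap_comp_norm {N : ℕ} {φ φ' : ℝ → ℝ} {φ'' : ℝ} {x : EuclideanSpace ℝ (Fin N)}
    (hx : x ≠ 0) (h : ∀ᶠ s in 𝓝 ‖x‖, HasDerivAt φ (φ' s) s) (h' : HasDerivAt φ' φ'' ‖x‖) :
    hypLap N (fun y => φ ‖y‖) x =
      ((1 - ‖x‖ ^ 2) / 2) ^ 2 * (φ'' + (N - 1) * φ' ‖x‖ / ‖x‖) +
        ((N : ℝ) - 2) * ((1 - ‖x‖ ^ 2) / 2) * (‖x‖ * φ' ‖x‖) := by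
  have hn : ‖x‖ ≠ 0 := norm_ne_zero_iff.2 hx
  have hχ : HasDerivAt (fun s => φ' s / s) ((φ'' * ‖x‖ - φ' ‖x‖ * 1) / ‖x‖ ^ 2) ‖x‖ :=
    h'.div (hasDerivAt_id _) hn
  have hE : eucLap (fun y : EuclideanSpace ℝ (Fin N) => φ ‖y‖) x =
      φ'' + (N - 1) * φ' ‖x‖ / ‖x‖ := by
    have hi : ∀ i : Fin N, fderiv ℝ (fun y => fderiv ℝ
        (fun y : EuclideanSpace ℝ (Fin N) => φ ‖y‖) y (EuclideanSpace.single i (1 : ℝ)))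
        x (EuclideanSpace.single i (1 : ℝ)) =
        x i ^ 2 * ((φ'' * ‖x‖ - φ' ‖x‖ * 1) / ‖x‖ ^ 2 / ‖x‖) + φ' ‖x‖ / ‖x‖ := by
      intro i
      have hev : (fun y => fderiv ℝ (fun y : EuclideanSpace ℝ (Fin N) => φ ‖y‖) y
          (EuclideanSpace.single i (1 : ℝ))) =ᶠ[𝓝 x] fun y => y i * (φ' ‖y‖ / ‖y‖) := by
        filter_upwards [continuous_norm.continuousAt.eventually h,
          isOpen_ne.mem_nhds hx] with y hy hy0
        rw [(hasFDerivAt_comp_norm hy0 hy).fderiv]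
        simp [EuclideanSpace.inner_single_right, mul_comm]
      rw [hev.fderiv_eq, (hasFDerivAt_coord_mul_comp_norm i hx hχ).fderiv]
      simp [EuclideanSpace.inner_single_right]
      ring
    rw [eucLap, Finset.sum_congr rfl fun i _ => hi i, Finset.sum_add_distrib, ← Finset.sum_mul,
      ← EuclideanSpace.real_norm_sq_eq]
    simp
    field_simp
    ring
  rw [hypLap, hE, (hasFDerivAt_comp_norm hx h.self_of_nhds).fderiv]
  simp only [smul_apply, innerSL_apply_apply, real_inner_self_eq_norm_sq,
    smul_eq_mul]
  field_simp

theorem hypLap_coord_mul_comp_norm {N : ℕ} (k : Fin N) {φ φ' : ℝ → ℝ} {φ'' : ℝ}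
    {x : EuclideanSpace ℝ (Fin N)} (hx : x ≠ 0)
    (h : ∀ᶠ s in 𝓝 ‖x‖, HasDerivAt φ (φ' s) s) (h' : HasDerivAt φ' φ'' ‖x‖) :
    hypLap N (fun y => y k * φ ‖y‖) x =
      x k * (((1 - ‖x‖ ^ 2) / 2) ^ 2 * (φ'' + (N + 1) * φ' ‖x‖ / ‖x‖) +
        ((N : ℝ) - 2) * ((1 - ‖x‖ ^ 2) / 2) * (φ ‖x‖ + ‖x‖ * φ' ‖x‖)) := by
  have hn : ‖x‖ ≠ 0 := norm_ne_zero_iff.2 hx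
  have hχ : HasDerivAt (fun s => φ' s / s) ((φ'' * ‖x‖ - φ' ‖x‖ * 1) / ‖x‖ ^ 2) ‖x‖ :=
    h'.div (hasDerivAt_id _) hn
  have hE : eucLap (fun y : EuclideanSpace ℝ (Fin N) => y k * φ ‖y‖) x =
      x k * (φ'' + (N + 1) * φ' ‖x‖ / ‖x‖) := by
    have hi : ∀ i : Fin N, fderiv ℝ (fun y => fderiv ℝ
        (fun y : EuclideanSpace ℝ (Fin N) => y k * φ ‖y‖) y (EuclideanSpace.single i (1 : ℝ)))
        x (EuclideanSpace.single i (1 : ℝ)) =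
        x k * (x i ^ 2 * ((φ'' * ‖x‖ - φ' ‖x‖ * 1) / ‖x‖ ^ 2 / ‖x‖) + φ' ‖x‖ / ‖x‖) +
          (if k = i then 2 * x i * (φ' ‖x‖ / ‖x‖) else 0) := by
      intro i
      have hev : (fun y => fderiv ℝ (fun y : EuclideanSpace ℝ (Fin N) => y k * φ ‖y‖) y
          (EuclideanSpace.single i (1 : ℝ))) =ᶠ[𝓝 x]
          fun y => y k * (y i * (φ' ‖y‖ / ‖y‖)) + φ ‖y‖ * (if k = i then 1 else 0) := by
        filter_upwards [continuous_norm.continuousAt.eventually h,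
          isOpen_ne.mem_nhds hx] with y hy hy0
        rw [(hasFDerivAt_coord_mul_comp_norm k hy0 hy).fderiv]
        simp [EuclideanSpace.inner_single_right, mul_comm]
      have hd := ((EuclideanSpace.proj (𝕜 := ℝ) k).hasFDerivAt (x := x)).mul
        (hasFDerivAt_coord_mul_comp_norm i hx hχ) |>.add
        ((hasFDerivAt_comp_norm hx h.self_of_nhds).mul_const (if k = i then (1 : ℝ) else 0))
      rw [hev.fderiv_eq]
      refine (congrArg (fun L => L (EuclideanSpace.single i (1 : ℝ))) hd.fderiv).trans ?_
      by_cases hki : k = i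
      · subst hki
        simp [EuclideanSpace.inner_single_right]
        ring
      · simp [EuclideanSpace.inner_single_right, hki]
        ring
    rw [eucLap, Finset.sum_congr rfl fun i _ => hi i, Finset.sum_add_distrib, ← Finset.mul_sum,
      Finset.sum_add_distrib, ← Finset.sum_mul, ← EuclideanSpace.real_norm_sq_eq]
    simp
    field_simp
    ring
  rw [hypLap, hE, (hasFDerivAt_coord_mul_comp_norm k hx h.self_of_nhds).fderiv]
  simp
  field_simp
  ring

/-- For a positive radial solution `u(x) = ũ(|x|)` of `−Δ_{B^N}u − λu = u^p`
on a geodesic ball `B` centered at the origin (vanishing on `∂B`), the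
function `v(x) = (x₁/|x|)(1−|x|²)ũ'(|x|)` satisfies the linearized equation
`−Δ_{B^N}v − λv = p u^{p−1}v` in `B \ {0}`. -/
theorem killing_deriv_solves_linearized (N : ℕ) (hN : 2 ≤ N) (p lam : ℝ)
    (hp : 1 < p) (R : ℝ) (hR0 : 0 < R) (hR1 : R < 1)
    (u : EuclideanSpace ℝ (Fin N) → ℝ) (ut : ℝ → ℝ)
    (hC2 : ContDiff ℝ 2 u) (hutC2 : ContDiff ℝ 2 ut)
    (hrad : ∀ x : EuclideanSpace ℝ (Fin N), ‖x‖ < 1 → u x = ut ‖x‖)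
    (hupos : ∀ x ∈ Metric.ball (0 : EuclideanSpace ℝ (Fin N)) R, 0 < u x)
    (hbdry : ∀ x : EuclideanSpace ℝ (Fin N), ‖x‖ = R → u x = 0)
    (hueq : ∀ x ∈ Metric.ball (0 : EuclideanSpace ℝ (Fin N)) R,
      -hypLap N u x - lam * u x = u x ^ p) :
    ∀ x ∈ Metric.ball (0 : EuclideanSpace ℝ (Fin N)) R, x ≠ 0 →
      -hypLap N (fun y => (y ⟨0, by omega⟩ / ‖y‖) * (1 - ‖y‖ ^ 2) * deriv ut ‖y‖) x -
          lam * ((x ⟨0, by omega⟩ / ‖x‖) * (1 - ‖x‖ ^ 2) * deriv ut ‖x‖) =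
        p * u x ^ (p - 1) *
          ((x ⟨0, by omega⟩ / ‖x‖) * (1 - ‖x‖ ^ 2) * deriv ut ‖x‖) := by
  intro x hx hx0
  rw [mem_ball_zero_iff] at hx
  set k : Fin N := ⟨0, by omega⟩
  set r := ‖x‖ with hr
  have hr0 : 0 < r := norm_pos_iff.2 hx0
  have hw : ∀ s, HasDerivAt ut (deriv ut s) s := fun s =>
    ((hutC2.differentiable (by norm_num)) s).hasDerivAt
  have hw1 : ∀ s, HasDerivAt (deriv ut) (deriv (deriv ut) s) s := fun s =>
    ((ContDiff.differentiable_deriv_two hutC2) s).hasDerivAt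
  have hpt : ∀ s, 0 < s → ∃ y : EuclideanSpace ℝ (Fin N), ‖y‖ = s :=
    fun s hs => ⟨EuclideanSpace.single k s, by simp [abs_of_pos hs]⟩
  have hODE : ∀ s, 0 < s → s < R →
      ((1 - s ^ 2) / 2) ^ 2 * (deriv (deriv ut) s + (N - 1) * deriv ut s / s) +
        ((N : ℝ) - 2) * ((1 - s ^ 2) / 2) * (s * deriv ut s) = -lam * ut s - ut s ^ p := by
    intro s hs hsR
    obtain ⟨y, rfl⟩ := hpt s hs
    have hy0 : y ≠ 0 := norm_pos_iff.1 hs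
    have hev : u =ᶠ[𝓝 y] fun z => ut ‖z‖ := by
      filter_upwards [continuous_norm.continuousAt.eventually (gt_mem_nhds (hsR.trans hR1))]
        with z hz using hrad z hz
    have := hueq y (mem_ball_zero_iff.2 hsR)
    rw [hypLap_congr hev, hypLap_comp_norm hy0 (Eventually.of_forall hw) (hw1 _),
      hrad y (hsR.trans hR1)] at this
    linarith
  have hupos' : 0 < ut r := by
    rw [hr, ← hrad x (hx.trans hR1)]; exact hupos x (mem_ball_zero_iff.2 hx)
  have ha : 0 < 1 - r ^ 2 := by nlinarith
  have hIoo : ∀ᶠ s in 𝓝 r, 0 < s ∧ s < R := Ioo_mem_nhds hr0 hx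
  have hF : HasDerivAt (fun s => -lam * ut s - ut s ^ p)
      (-lam * deriv ut r - deriv ut r * p * ut r ^ (p - 1)) r :=
    ((hw r).const_mul (-lam)).sub ((hw r).rpow_const (Or.inl hupos'.ne'))
  have hA : HasDerivAt (fun s : ℝ => (1 - s ^ 2) / 2) (-r) r := by
    refine ((((hasDerivAt_id r).pow 2).const_sub 1).div_const 2).congr_deriv ?_
    simp
    ring
  have hdiff : DifferentiableAt ℝ (deriv (deriv ut)) r := by
    have hG : DifferentiableAt ℝ (fun s => (-lam * ut s - ut s ^ p -
        ((N : ℝ) - 2) * ((1 - s ^ 2) / 2) * (s * deriv ut s)) / ((1 - s ^ 2) / 2) ^ 2 -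
        (N - 1) * deriv ut s / s) r :=
      ((hF.differentiableAt.sub ((hA.differentiableAt.const_mul _).mul
        (differentiableAt_id.mul (hw1 r).differentiableAt))).div
        (hA.differentiableAt.pow 2) (pow_ne_zero 2 (half_pos ha).ne')).sub
        (((hw1 r).differentiableAt.const_mul _).div differentiableAt_id hr0.ne')
    refine hG.congr_of_eventuallyEq ?_
    filter_upwards [hIoo] with s hs
    have hs2 : 0 < 1 - s ^ 2 := by nlinarith
    rw [← hODE s hs.1 hs.2]
    field_simp
    ring
  have hw2 := hdiff.hasDerivAt
  set w2 := deriv (deriv (deriv ut)) r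
  have hODE' := ((((hA.pow 2).mul (hw2.add (((hw1 r).const_mul ((N : ℝ) - 1)).div
    (hasDerivAt_id r) hr0.ne'))).add ((hA.const_mul ((N : ℝ) - 2)).mul
    ((hasDerivAt_id r).mul (hw1 r)))).congr_of_eventuallyEq (f₁ := fun s => -lam * ut s - ut s ^ p)
    (hIoo.mono fun s hs => (hODE s hs.1 hs.2).symm)).unique hF
  have hv : ∀ s ≠ 0, HasDerivAt (fun s => (1 - s ^ 2) * deriv ut s / s)
      (((-(2 * s)) * deriv ut s + (1 - s ^ 2) * deriv (deriv ut) s) / s -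
        (1 - s ^ 2) * deriv ut s / s ^ 2) s := by
    intro s hs
    have h1 := (((((hasDerivAt_id s).pow 2).const_sub 1).mul (hw1 s)).div (hasDerivAt_id s) hs)
    refine h1.congr_deriv ?_
    simp
    field_simp
  have hq : HasDerivAt (fun s : ℝ => 1 - s ^ 2) (-(2 * r)) r := by
    refine (((hasDerivAt_id r).pow 2).const_sub 1).congr_deriv ?_
    simp
  have hv' := (((((hasDerivAt_id r).const_mul 2).neg.mul (hw1 r)).add (hq.mul hw2)).div
    (hasDerivAt_id r) hr0.ne').sub ((hq.mul (hw1 r)).div ((hasDerivAt_id r).pow 2)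
      (pow_ne_zero 2 hr0.ne'))
  have hfun : (fun y : EuclideanSpace ℝ (Fin N) =>
      (y k / ‖y‖) * (1 - ‖y‖ ^ 2) * deriv ut ‖y‖) =
      fun y => y k * ((1 - ‖y‖ ^ 2) * deriv ut ‖y‖ / ‖y‖) := by
    funext y; ring
  have hmain := hypLap_coord_mul_comp_norm k hx0
    ((eventually_ne_nhds hr0.ne').mono hv) hv'
  rw [hfun, hmain, hrad x (hx.trans hR1), ← hr]
  simp only [Pi.add_apply, Pi.mul_apply, Pi.pow_apply, id, Pi.div_apply, Pi.neg_apply,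
    Nat.cast_ofNat, Nat.add_one_sub_one, pow_one] at hODE' ⊢
  field_simp at hODE' ⊢
  norm_num at hODE' ⊢
  linear_combination -(x k) * hODE'
end

section
/- Let N ≥ 2, p > 1, λ < ((N−1)/2)² and let u be a positive C² solution on (0,∞) of u'' + (N−1)coth(t)u' + λu + u^p = 0 with ∫₀^∞ (u² + (u')²)(sinh t)^{N−1} dt < ∞. Then lim_{t→∞} u'(t)/u(t) = −(N−1 + √((N−1)² − 4λ))/2 (assuming the limit of the logarithmic derivative exists as stated in the decay estimates). -/
open MeasureTheory Filter

/-- A solution of a perturbed Riccati equation that starts above the repelling equilibrium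
`-(n / 2 + r)` eventually stays above `-n / 2`. -/
lemma riccati_eventually_ge {n r δ T : ℝ} {w k q : ℝ → ℝ} (hn : 0 < n) (hδ : 0 < δ) (hδr : δ ≤ r)
    (hw : ∀ t ≥ T, HasDerivAt w (-(w t) ^ 2 - n * k t * w t - (n ^ 2 / 4 - r ^ 2) - q t) t)
    (hk : ∀ t ≥ T, 1 ≤ k t) (hq : ∀ t ≥ T, q t < δ * r / 2)
    (hT : -(n / 2 + r) + δ ≤ w T) : ∃ S ≥ T, ∀ t ≥ S, -(n / 2) ≤ w t := by
  have hr : 0 < r := hδ.trans_le hδr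
  have hc : 0 < δ * r / 2 := by positivity
  -- on the strip between the two levels the vector field exceeds `δ * r / 2`
  have key : ∀ t ≥ T, ∀ b, -(n / 2 + r) + δ ≤ b → b ≤ -(n / 2) →
      δ * r / 2 < -b ^ 2 - n * k t * b - (n ^ 2 / 4 - r ^ 2) - q t := by
    intro t ht b hb1 hb2
    have h1 := hk t ht
    have h2 := hq t ht
    have h3 : 0 ≤ n * (k t - 1) * (-b) :=
      mul_nonneg (mul_nonneg hn.le (by linarith)) (by linarith)
    have h4 : δ * r ≤ (n / 2 + r + b) * (r - b - n / 2) :=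
      mul_le_mul (by linarith) (by linarith) hr.le (by linarith)
    nlinarith
  have hwc : ∀ a b, T ≤ a → ContinuousOn (fun t => -w t) (Set.Icc a b) := fun a b ha t ht =>
    (hw t (ha.trans ht.1)).continuousAt.neg.continuousWithinAt
  set S : ℝ := T + (r - δ) / (δ * r / 2) with hS
  have hTS : T ≤ S := by
    have : 0 ≤ (r - δ) / (δ * r / 2) := div_nonneg (by linarith) hc.le
    linarith
  have hSe : δ * r / 2 * (S - T) = r - δ := by
    rw [hS]; field_simp; ring
  have hwS : -(n / 2) ≤ w S := by
    have := image_le_of_deriv_right_lt_deriv_boundary (hwc T S le_rfl)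
      (fun t ht => ((hw t ht.1).neg).hasDerivWithinAt)
      (B := fun t => (n / 2 + r) - δ - δ * r / 2 * (t - T)) (B' := fun _ => -(δ * r / 2))
      (by linarith)
      (fun t => by
        simpa using (((hasDerivAt_id t).sub_const T).const_mul (δ * r / 2)).const_sub
          ((n / 2 + r) - δ))
      (fun t ht he => by
        have h1 : δ * r / 2 * (t - T) ≤ δ * r / 2 * (S - T) :=
          mul_le_mul_of_nonneg_left (by linarith [ht.2]) hc.le
        have h2 : 0 ≤ δ * r / 2 * (t - T) := mul_nonneg hc.le (by linarith [ht.1])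
        have := key t ht.1 (w t) (by linarith) (by linarith)
        linarith)
      (Set.right_mem_Icc.2 hTS)
    linarith
  refine ⟨S, hTS, fun t ht => ?_⟩
  have := image_le_of_deriv_right_lt_deriv_boundary (hwc S t hTS)
    (fun x hx => ((hw x (hTS.trans hx.1)).neg).hasDerivWithinAt)
    (B := fun _ => n / 2) (B' := fun _ => 0)
    (by linarith)
    (fun x => hasDerivAt_const x _)
    (fun x hx he => by
      have := key x (hTS.trans hx.1) (w x) (by linarith) (by linarith)
      linarith)
    (Set.right_mem_Icc.2 ht)
  linarith

/-- A global solution of a perturbed Riccati equation cannot be below the repelling equilibrium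
`-(n / 2 + r)` at late times, for it would blow up in finite time. -/
lemma riccati_lower_bound {n r δ : ℝ} (hn : 0 < n) (hr : 0 < r) (hδ : 0 < δ) :
    ∃ ε > 0, ∀ (T : ℝ) (w k q : ℝ → ℝ),
      (∀ t ≥ T, HasDerivAt w (-(w t) ^ 2 - n * k t * w t - (n ^ 2 / 4 - r ^ 2) - q t) t) →
      (∀ t ≥ T, k t ≤ 1 + ε) → (∀ t ≥ T, 0 ≤ q t) → -(n / 2 + r) - δ < w T := by
  set a : ℝ := n / 2 + r + δ with ha
  have ha0 : 0 < a := by positivity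
  set ε : ℝ := (δ / a) ^ 2 / (2 * (1 + n / a)) with hε
  have hε0 : 0 < ε := by positivity
  have hε1 : 2 * (ε * (1 + n / a)) = (δ / a) ^ 2 := by
    rw [hε]; field_simp
  refine ⟨ε, hε0, fun T w k q hw hk hq => ?_⟩
  have key : ∀ t ≥ T, ∀ x ≥ a,
      -x ^ 2 + n * k t * x - (n ^ 2 / 4 - r ^ 2) - q t < -(ε * x ^ 2) := by
    intro t ht x hx
    have hx0 : 0 < x := ha0.trans_le hx
    have h1 : n * k t * x ≤ n * (1 + ε) * x :=
      mul_le_mul_of_nonneg_right (mul_le_mul_of_nonneg_left (hk t ht) hn.le) hx0.le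
    have h2 := hq t ht
    have h3 : δ / a * x ≤ x - (n / 2 + r) := by
      rw [div_mul_eq_mul_div, div_le_iff₀ ha0]
      nlinarith
    have h4 : (δ / a * x) ^ 2 ≤ (x - (n / 2 + r)) ^ 2 :=
      pow_le_pow_left₀ (by positivity) h3 2
    have h5 : x ≤ x ^ 2 / a := by
      rw [le_div_iff₀ ha0]; nlinarith
    have h6 : n * ε * x ≤ n * ε * (x ^ 2 / a) := mul_le_mul_of_nonneg_left h5 (by positivity)
    have h7 : ε * x ^ 2 + n * ε * (x ^ 2 / a) = (δ / a) ^ 2 / 2 * x ^ 2 := by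
      rw [← hε1]; ring
    have h8 : 0 < (δ / a) ^ 2 / 2 * x ^ 2 := by positivity
    have h9 : 0 ≤ r * (x - (n / 2 + r)) := mul_nonneg hr.le (by linarith)
    nlinarith
  by_contra! hT
  obtain ⟨K, hK⟩ : ∃ K, ∀ t ∈ Set.Icc T (T + 1 / (a * ε)), K ≤ w t := by
    obtain ⟨K, hK⟩ := (isCompact_Icc (a := T) (b := T + 1 / (a * ε))).bddBelow_image
      (f := w) (fun t ht => (hw t ht.1).continuousAt.continuousWithinAt)
    exact ⟨K, fun t ht => hK ⟨t, ht, rfl⟩⟩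
  set L : ℝ := max a (1 - K) with hL
  have hLa : a ≤ L := le_max_left _ _
  have hL0 : 0 < L := ha0.trans_le hLa
  set S : ℝ := T + (1 / a - 1 / L) / ε with hS
  have hSe : ε * (S - T) = 1 / a - 1 / L := by
    rw [hS]; field_simp; ring
  have hTS : T ≤ S := by
    have : 0 ≤ (1 / a - 1 / L) / ε :=
      div_nonneg (sub_nonneg.2 (one_div_le_one_div_of_le ha0 hLa)) hε0.le
    linarith
  have hs : ∀ t ≤ S, 1 / L ≤ 1 / a - ε * (t - T) := fun t ht => by
    have : ε * (t - T) ≤ ε * (S - T) := mul_le_mul_of_nonneg_left (by linarith) hε0.le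
    linarith
  have hL1 : 0 < 1 / L := by positivity
  have := image_le_of_deriv_right_lt_deriv_boundary' (f := w) (a := T) (b := S)
    (fun t ht => (hw t ht.1).continuousAt.continuousWithinAt)
    (fun t ht => (hw t ht.1).hasDerivWithinAt)
    (B := fun t => -(1 / a - ε * (t - T))⁻¹)
    (B' := fun t => -(ε * ((1 / a - ε * (t - T))⁻¹) ^ 2))
    (by simp; linarith)
    (fun t ht => by
      have h0 := hs t ht.2
      exact ContinuousAt.continuousWithinAt (by
        have : 1 / a - ε * (t - T) ≠ 0 := by linarith
        fun_prop (disch := assumption)))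
    (fun t ht => by
      have h0 := hs t ht.2.le
      have hne : 1 / a - ε * (t - T) ≠ 0 := by linarith
      have hd : HasDerivAt (fun t => 1 / a - ε * (t - T)) (-ε) t := by
        simpa using (((hasDerivAt_id t).sub_const T).const_mul ε).const_sub (1 / a)
      refine ((hd.inv hne).neg.congr_deriv ?_).hasDerivWithinAt
      field_simp)
    (fun t ht he => by
      have h0 := hs t ht.2.le
      have h1 : a ≤ (1 / a - ε * (t - T))⁻¹ := by
        rw [le_inv_comm₀ ha0 (by linarith), ← one_div]
        have : 0 ≤ ε * (t - T) := mul_nonneg hε0.le (by linarith [ht.1])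
        linarith
      have := key t ht.1 _ h1
      rw [he]
      linarith)
    (Set.right_mem_Icc.2 hTS)
  have hval : (1 / a - ε * (S - T))⁻¹ = L := by rw [hSe]; simp
  simp only [hval] at this
  have hSu : S ≤ T + 1 / (a * ε) := by
    have h1 : 1 / (a * ε) = (1 / a) / ε := by field_simp
    have h2 : (1 / a - 1 / L) / ε ≤ (1 / a) / ε :=
      div_le_div_of_nonneg_right (by linarith) hε0.le
    linarith
  have h1 := hK S ⟨hTS, hSu⟩
  have h2 : 1 - K ≤ L := le_max_right _ _
  linarith

lemma one_lt_cosh_div_sinh {t : ℝ} (ht : 0 < t) : 1 < Real.cosh t / Real.sinh t := by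
  rw [one_lt_div (Real.sinh_pos_iff.2 ht)]
  exact Real.sinh_lt_cosh t

lemma cosh_div_sinh_le {t : ℝ} (ht : 1 ≤ t) :
    Real.cosh t / Real.sinh t ≤ 1 + Real.exp (-t) := by
  have h1 : 1 ≤ Real.sinh t := ht.trans (Real.self_le_sinh_iff.2 (by linarith))
  rw [div_le_iff₀ (by linarith)]
  have h2 := Real.cosh_sub_sinh t
  nlinarith [Real.exp_pos (-t)]

lemma hasDerivAt_sq_mul_sinh_rpow {u : ℝ → ℝ} {u' m t : ℝ} (ht : 0 < t) (hu : HasDerivAt u u' t) :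
    HasDerivAt (fun t => u t ^ 2 * Real.sinh t ^ m)
      ((2 * u t * u' + m * (Real.cosh t / Real.sinh t) * u t ^ 2) * Real.sinh t ^ m) t := by
  have hs : 0 < Real.sinh t := Real.sinh_pos_iff.2 ht
  refine ((hu.pow 2).mul
    ((Real.hasDerivAt_sinh t).rpow_const (p := m) (Or.inl hs.ne'))).congr_deriv ?_
  rw [Real.rpow_sub_one hs.ne']
  simp
  field_simp

/-- Finite weighted energy forces `u ^ 2 * sinh ^ m` to vanish at infinity. -/
lemma tendsto_sq_mul_sinh_rpow {u u' : ℝ → ℝ} {m : ℝ} (hm : 0 ≤ m)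
    (hu : ∀ t > 0, HasDerivAt u (u' t) t) (hu' : ContinuousOn u' (Set.Ioi 0))
    (hE : IntegrableOn (fun t => (u t ^ 2 + u' t ^ 2) * Real.sinh t ^ m) (Set.Ioi 0)) :
    Tendsto (fun t => u t ^ 2 * Real.sinh t ^ m) atTop (nhds 0) := by
  have hE1 : IntegrableOn (fun t => (u t ^ 2 + u' t ^ 2) * Real.sinh t ^ m) (Set.Ioi 1) :=
    hE.mono_set (Set.Ioi_subset_Ioi zero_le_one)
  have huc : ContinuousOn u (Set.Ioi 1) := fun t ht =>
    (hu t (zero_lt_one.trans ht)).continuousAt.continuousWithinAt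
  have hu'c : ContinuousOn u' (Set.Ioi 1) := hu'.mono (Set.Ioi_subset_Ioi zero_le_one)
  have hspos : ∀ t ∈ Set.Ioi (1 : ℝ), 0 < Real.sinh t := fun t ht =>
    Real.sinh_pos_iff.2 (zero_lt_one.trans ht)
  have hsc : ContinuousOn (fun t => Real.sinh t ^ m) (Set.Ioi 1) :=
    Real.continuous_sinh.continuousOn.rpow_const fun t ht => Or.inl (hspos t ht).ne'
  have hcc : ContinuousOn (fun t => Real.cosh t / Real.sinh t) (Set.Ioi 1) :=
    Real.continuous_cosh.continuousOn.div Real.continuous_sinh.continuousOn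
      fun t ht => (hspos t ht).ne'
  refine tendsto_zero_of_hasDerivAt_of_integrableOn_Ioi (a := 1)
    (fun t ht => hasDerivAt_sq_mul_sinh_rpow (zero_lt_one.trans ht)
      (hu t (zero_lt_one.trans ht))) ?_ ?_
  · refine (hE1.const_mul (1 + 2 * m)).mono' ?_ ?_
    · refine ContinuousOn.aestronglyMeasurable ?_ measurableSet_Ioi
      fun_prop
    · refine (ae_restrict_iff' measurableSet_Ioi).2 (Eventually.of_forall fun t ht => ?_)
      have ht1 : (1 : ℝ) < t := ht
      have hp : 0 < Real.sinh t ^ m := Real.rpow_pos_of_pos (hspos t ht) _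
      have hc2 : Real.cosh t / Real.sinh t ≤ 2 := by
        have := cosh_div_sinh_le ht1.le
        have : Real.exp (-t) ≤ 1 := Real.exp_le_one_iff.2 (by linarith)
        linarith
      have hc0 := one_lt_cosh_div_sinh (zero_lt_one.trans ht1)
      have h1 : |2 * u t * u' t| ≤ u t ^ 2 + u' t ^ 2 :=
        abs_le.2 ⟨by nlinarith [sq_nonneg (u t + u' t)], by nlinarith [sq_nonneg (u t - u' t)]⟩
      have h2 : |m * (Real.cosh t / Real.sinh t) * u t ^ 2| ≤ m * 2 * (u t ^ 2 + u' t ^ 2) := by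
        rw [abs_of_nonneg (by positivity)]
        gcongr
        exact le_add_of_nonneg_right (sq_nonneg _)
      rw [Real.norm_eq_abs, abs_mul, abs_of_pos hp, ← mul_assoc]
      refine mul_le_mul_of_nonneg_right ((abs_add_le _ _).trans ?_) hp.le
      linarith
  · refine hE1.mono' ?_ ?_
    · refine ContinuousOn.aestronglyMeasurable ?_ measurableSet_Ioi
      fun_prop
    · refine (ae_restrict_iff' measurableSet_Ioi).2 (Eventually.of_forall fun t ht => ?_)
      have hp : 0 < Real.sinh t ^ m := Real.rpow_pos_of_pos (hspos t ht) _
      rw [Real.norm_eq_abs, abs_of_nonneg (by positivity)]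
      exact mul_le_mul_of_nonneg_right (le_add_of_nonneg_right (sq_nonneg _)) hp.le

/-- Decay estimate: a finite-energy positive solution of the radial hyperbolic
ODE has logarithmic derivative tending to `−(N−1+√((N−1)²−4λ))/2` at infinity. -/
theorem log_deriv_limit (N : ℕ) (hN : 2 ≤ N) (p lam : ℝ) (hp : 1 < p)
    (hlam : lam < (((N : ℝ) - 1) / 2) ^ 2)
    (u : ℝ → ℝ) (hupos : ∀ t > (0 : ℝ), 0 < u t)
    (hC2 : ContDiffOn ℝ 2 u (Set.Ioi (0 : ℝ)))
    (hode : ∀ t > (0 : ℝ),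
      deriv (deriv u) t + ((N : ℝ) - 1) * (Real.cosh t / Real.sinh t) * deriv u t +
        lam * u t + u t ^ p = 0)
    (henergy : IntegrableOn
      (fun t => ((u t) ^ 2 + (deriv u t) ^ 2) * Real.sinh t ^ ((N : ℝ) - 1))
      (Set.Ioi (0 : ℝ)) volume) :
    Tendsto (fun t => deriv u t / u t) atTop
      (nhds (-(((N : ℝ) - 1 + Real.sqrt (((N : ℝ) - 1) ^ 2 - 4 * lam)) / 2))) := by
  have hN' : (2 : ℝ) ≤ N := by exact_mod_cast hN
  set n : ℝ := (N : ℝ) - 1 with hn_def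
  have hn : 0 < n := by linarith
  have hdisc : 0 < n ^ 2 - 4 * lam := by nlinarith
  set r : ℝ := Real.sqrt (n ^ 2 - 4 * lam) / 2 with hr_def
  have hr : 0 < r := by positivity
  have hlam_eq : lam = n ^ 2 / 4 - r ^ 2 := by
    rw [hr_def, div_pow, Real.sq_sqrt hdisc.le]; ring
  have hlim : -((n + Real.sqrt (n ^ 2 - 4 * lam)) / 2) = -(n / 2 + r) := by rw [hr_def]; ring
  rw [hlim]
  have hC1 : ContDiffOn ℝ 1 (deriv u) (Set.Ioi 0) :=
    hC2.deriv_of_isOpen isOpen_Ioi (by norm_num)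
  have hu1 : ∀ t > 0, HasDerivAt u (deriv u t) t := fun t ht =>
    ((hC2.differentiableOn (by norm_num)).differentiableAt (Ioi_mem_nhds ht)).hasDerivAt
  have hu2 : ∀ t > 0, HasDerivAt (deriv u) (deriv (deriv u) t) t := fun t ht =>
    ((hC1.differentiableOn (by norm_num)).differentiableAt (Ioi_mem_nhds ht)).hasDerivAt
  have hF := tendsto_sq_mul_sinh_rpow hn.le hu1 hC1.continuousOn henergy
  set w : ℝ → ℝ := fun t => deriv u t / u t with hw_def
  set k : ℝ → ℝ := fun t => Real.cosh t / Real.sinh t with hk_def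
  set q : ℝ → ℝ := fun t => u t ^ (p - 1) with hq_def
  have hw : ∀ t > 0, HasDerivAt w
      (-(w t) ^ 2 - n * k t * w t - (n ^ 2 / 4 - r ^ 2) - q t) t := by
    intro t ht
    have h0 := hupos t ht
    refine ((hu2 t ht).div (hu1 t ht) h0.ne').congr_deriv ?_
    have h2 : deriv (deriv u) t = -(n * k t * deriv u t + lam * u t + u t * q t) := by
      have h3 : u t ^ p = u t * q t := by
        rw [hq_def, mul_comm, ← Real.rpow_add_one h0.ne']; simp
      have h4 : deriv (deriv u) t + n * k t * deriv u t + lam * u t + u t ^ p = 0 := hode t ht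
      rw [h3] at h4
      linarith
    rw [h2, ← hlam_eq]
    simp only [hw_def]
    field_simp
    ring
  have hu_lim : Tendsto u atTop (nhds 0) := by
    have hsq : Tendsto (fun t => u t ^ 2) atTop (nhds 0) := by
      refine squeeze_zero' (Eventually.of_forall fun t => sq_nonneg _) ?_ hF
      filter_upwards [eventually_ge_atTop 1] with t ht
      have h1 : 1 ≤ Real.sinh t := ht.trans (Real.self_le_sinh_iff.2 (by linarith))
      exact le_mul_of_one_le_right (sq_nonneg _) (Real.one_le_rpow h1 hn.le)
    have habs : Tendsto (fun t => |u t|) atTop (nhds 0) := by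
      simpa [Real.sqrt_sq_eq_abs] using hsq.sqrt
    exact tendsto_zero_iff_abs_tendsto_zero _ |>.2 habs
  have hq_lim : Tendsto q atTop (nhds 0) := by
    have := hu_lim.rpow_const (p := p - 1) (Or.inr (by linarith))
    rwa [Real.zero_rpow (by linarith)] at this
  have hk_ge : ∀ t > 0, 1 ≤ k t := fun t ht => (one_lt_cosh_div_sinh ht).le
  refine tendsto_order.2 ⟨fun a ha => ?_, fun a ha => ?_⟩
  · obtain ⟨ε, hε, H⟩ := riccati_lower_bound hn hr (δ := -(n / 2 + r) - a) (by linarith)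
    have hk_le : ∀ᶠ t in atTop, k t ≤ 1 + ε := by
      have := (Real.tendsto_exp_neg_atTop_nhds_zero).eventually (gt_mem_nhds hε)
      filter_upwards [this, eventually_ge_atTop 1] with t ht ht1
      linarith [cosh_div_sinh_le ht1]
    filter_upwards [eventually_forall_ge_atTop.2 hk_le, eventually_gt_atTop 0] with T hT hT0
    have := H T w k q (fun t ht => hw t (hT0.trans_le ht)) hT
      (fun t ht => (Real.rpow_pos_of_pos (hupos t (hT0.trans_le ht)) _).le)
    linarith
  · set δ : ℝ := min (a + (n / 2 + r)) r with hδ_def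
    have hδ : 0 < δ := lt_min (by linarith) hr
    have hδa : δ ≤ a + (n / 2 + r) := min_le_left _ _
    have hq_small : ∀ᶠ t in atTop, q t < δ * r / 2 :=
      hq_lim.eventually (gt_mem_nhds (by positivity))
    filter_upwards [eventually_forall_ge_atTop.2 hq_small, eventually_gt_atTop 0] with T hT hT0
    by_contra! hwT
    obtain ⟨S, hS, hwS⟩ := riccati_eventually_ge hn hδ (min_le_right _ _)
      (fun t ht => hw t (hT0.trans_le ht)) (fun t ht => hk_ge t (hT0.trans_le ht)) hT
      (by linarith)
    have hS0 : 0 < S := hT0.trans_le hS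
    -- `u ^ 2 * sinh ^ n` is then positive and nondecreasing, so it cannot tend to zero
    have hmono : MonotoneOn (fun t => u t ^ 2 * Real.sinh t ^ n) (Set.Ici S) := by
      have hd : ∀ t ≥ S, HasDerivAt (fun t => u t ^ 2 * Real.sinh t ^ n) _ t := fun t ht =>
        hasDerivAt_sq_mul_sinh_rpow (hS0.trans_le ht) (hu1 t (hS0.trans_le ht))
      refine monotoneOn_of_deriv_nonneg (convex_Ici S)
        (fun t ht => (hd t ht).continuousAt.continuousWithinAt)
        (fun t ht => (hd t (interior_subset ht)).differentiableAt.differentiableWithinAt)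
        (fun t ht => ?_)
      have htS : S ≤ t := interior_subset ht
      have ht0 : 0 < t := hS0.trans_le htS
      have h0 := hupos t ht0
      rw [(hd t htS).deriv]
      refine mul_nonneg ?_ (Real.rpow_nonneg (Real.sinh_pos_iff.2 ht0).le _)
      have h1 : deriv u t = w t * u t := by simp only [hw_def]; field_simp
      have h2 : 2 * u t * deriv u t + n * (Real.cosh t / Real.sinh t) * u t ^ 2
          = (2 * w t + n * k t) * u t ^ 2 := by rw [h1]; ring
      rw [h2]
      have h3 := hwS t htS
      have h4 : n * 1 ≤ n * k t := mul_le_mul_of_nonneg_left (hk_ge t ht0) hn.le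
      exact mul_nonneg (by linarith) (sq_nonneg _)
    have hpos : 0 < u S ^ 2 * Real.sinh S ^ n :=
      mul_pos (pow_pos (hupos S hS0) 2) (Real.rpow_pos_of_pos (Real.sinh_pos_iff.2 hS0) _)
    have := ge_of_tendsto hF (b := u S ^ 2 * Real.sinh S ^ n) (by
      filter_upwards [eventually_ge_atTop S] with t ht
      exact hmono Set.self_mem_Ici ht ht)
    linarith
end
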